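/- There exist rationals α₂, α₃, α₄, α₅ such that ∑_{k=1}^∞ (H_k · H_{k+1} · H_{k+2} · H_{k+3}) / (k·(k+1)·(k+2)·(k+3)) = α₂·ζ(2) + α₃·ζ(3) + α₄·ζ(4) + α₅·ζ(5) if and only if ζ(2)·ζ(3) lies in the ℚ-linear span of the set {ζ(2), ζ(3), ζ(4), ζ(5)} inside the real numbers. -/

import Mathlib

/-- `harm k` is the `k`-th harmonic number `H_k = 1 + 1/2 + ⋯ + 1/k`. -/
noncomputable def harm (k : ℕ) : ℝ := ∑ i ∈ Finset.range k, (1 : ℝ) / (i + 1)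

/-- `zeta m = ∑_{k=1}^∞ 1/k^m`, the Riemann zeta function at a natural argument. -/
noncomputable def zeta (m : ℕ) : ℝ := ∑' n : ℕ, (1 : ℝ) / (n + 1) ^ m

open Filter Topology Finset

/-! ### Harmonic numbers and zeta values -/

/-- The generalized harmonic number `∑_{i=1}^n 1/i^s`. -/
noncomputable def genHarm (s n : ℕ) : ℝ := ∑ i ∈ range n, (1 : ℝ) / (i + 1) ^ s

lemma harm_zero : harm 0 = 0 := by simp [harm]

lemma harm_succ (n : ℕ) : harm (n + 1) = harm n + 1 / ((n : ℝ) + 1) := by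
  simp [harm, sum_range_succ]

lemma harm_nonneg (n : ℕ) : 0 ≤ harm n := sum_nonneg fun i _ => by positivity

lemma genHarm_zero (s : ℕ) : genHarm s 0 = 0 := by simp [genHarm]

lemma genHarm_one (n : ℕ) : genHarm 1 n = harm n := by simp [genHarm, harm]

lemma genHarm_succ (s n : ℕ) : genHarm s (n + 1) = genHarm s n + 1 / ((n : ℝ) + 1) ^ s := by
  simp [genHarm, sum_range_succ]

lemma genHarm_nonneg (s n : ℕ) : 0 ≤ genHarm s n := sum_nonneg fun i _ => by positivity

lemma hasSum_zeta {s : ℕ} (hs : 2 ≤ s) :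
    HasSum (fun n : ℕ => (1 : ℝ) / ((n : ℝ) + 1) ^ s) (zeta s) := by
  have h : Summable fun n : ℕ => (1 : ℝ) / (n : ℝ) ^ s := by
    rw [Real.summable_one_div_nat_pow]; omega
  have h' := (summable_nat_add_iff 1).2 h
  simp only [Nat.cast_add, Nat.cast_one] at h'
  exact h'.hasSum

lemma zeta_eq_of_hasSum {s : ℕ} (hs : s ≠ 0) {a : ℝ}
    (h : HasSum (fun n : ℕ => (1 : ℝ) / (n : ℝ) ^ s) a) : zeta s = a := by
  have h' := (hasSum_nat_add_iff' 1).2 h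
  simp only [Nat.cast_add, Nat.cast_one] at h'
  simpa [zeta, hs] using h'.tsum_eq

lemma zeta_two_sq : zeta 2 ^ 2 = 5 / 2 * zeta 4 := by
  rw [zeta_eq_of_hasSum two_ne_zero hasSum_zeta_two,
    zeta_eq_of_hasSum four_ne_zero hasSum_zeta_four]
  ring

lemma harm_le_log (n : ℕ) : harm n ≤ Real.log (Real.exp 1 * ((n : ℝ) + 1)) := by
  have h : harm n = (harmonic n : ℝ) := by
    simp [harm, harmonic]
  rw [h, Real.log_mul (Real.exp_ne_zero 1) (by positivity), Real.log_exp]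
  refine (harmonic_le_one_add_log n).trans ?_
  rcases Nat.eq_zero_or_pos n with rfl | hn
  · simp
  · have : (0 : ℝ) < n := by exact_mod_cast hn
    gcongr
    linarith

lemma tendsto_harm_pow_div (a j : ℕ) {b : ℕ} (hb : b ≠ 0) :
    Tendsto (fun k : ℕ => harm k ^ a / ((k : ℝ) + 1 + j) ^ b) atTop (𝓝 0) := by
  have hx : Tendsto (fun k : ℕ => Real.exp 1 * ((k : ℝ) + 1)) atTop atTop :=
    (tendsto_atTop_add_const_right _ _ tendsto_natCast_atTop_atTop).const_mul_atTop
      (Real.exp_pos 1)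
  have h := ((Real.isLittleO_pow_log_id_atTop (n := a)).tendsto_div_nhds_zero.comp hx).const_mul
    (Real.exp 1)
  rw [mul_zero] at h
  refine squeeze_zero (fun k => ?_) (fun k => ?_) h
  · have := harm_nonneg k
    positivity
  · have h0 := harm_nonneg k
    have hk : (1 : ℝ) ≤ (k : ℝ) + 1 + j := by
      have : (0 : ℝ) ≤ (k : ℝ) + j := by positivity
      linarith
    have hden : (k : ℝ) + 1 ≤ ((k : ℝ) + 1 + j) ^ b :=
      le_trans (by simp) (le_self_pow₀ hk hb)
    calc harm k ^ a / ((k : ℝ) + 1 + j) ^ b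
        ≤ Real.log (Real.exp 1 * ((k : ℝ) + 1)) ^ a / ((k : ℝ) + 1) := by
          have hlog := harm_le_log k
          have := h0.trans hlog
          gcongr
      _ = _ := by
          have := Real.exp_pos 1
          simp only [Function.comp, id]
          field_simp

/-! ### Summation of nonnegative series -/

lemma hasSum_of_nonneg_of_telescope {f g : ℕ → ℝ} {a : ℝ} (hf : ∀ n, 0 ≤ f n)
    (hfg : ∀ n, f n = g (n + 1) - g n) (hg : Tendsto g atTop (𝓝 a)) : HasSum f (a - g 0) := by
  rw [hasSum_iff_tendsto_nat_of_nonneg hf]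
  simp only [hfg, sum_range_sub]
  exact hg.sub_const _

lemma hasSum_prod_of_nonneg {F : ℕ × ℕ → ℝ} {A : ℕ → ℝ} {s : ℝ} (hF : 0 ≤ F)
    (hA : ∀ n, HasSum (fun m => F (n, m)) (A n)) (hs : HasSum A s) : HasSum F s := by
  have hsum : Summable F := by
    refine (summable_prod_of_nonneg hF).2 ⟨fun n => (hA n).summable, ?_⟩
    simpa only [(hA _).tsum_eq] using hs.summable
  rw [← (hsum.hasSum.prod_fiberwise hA).unique hs]
  exact hsum.hasSum

lemma HasSum.sum_antidiagonal {F : ℕ × ℕ → ℝ} {s : ℝ} (h : HasSum F s) :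
    HasSum (fun N => ∑ p ∈ antidiagonal N, F p) s :=
  (HasAntidiagonal.sigmaAntidiagonalEquivProd.hasSum_iff.2 h).sigma fun N =>
    (antidiagonal N).hasSum F

lemma HasSum.prod_fiberwise_swap {F : ℕ × ℕ → ℝ} {B : ℕ → ℝ} {s : ℝ} (h : HasSum F s)
    (hB : ∀ m, HasSum (fun n => F (n, m)) (B m)) : HasSum B s :=
  ((Equiv.prodComm ℕ ℕ).hasSum_iff.2 h).prod_fiberwise hB

/-! ### The stuffle product -/

lemma hasSum_stuffle {s t : ℕ} (hs : 2 ≤ s) (ht : 2 ≤ t) :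
    HasSum (fun n : ℕ => genHarm s n / ((n : ℝ) + 1) ^ t + genHarm t n / ((n : ℝ) + 1) ^ s
      + 1 / ((n : ℝ) + 1) ^ (s + t)) (zeta s * zeta t) := by
  have h := hasSum_of_nonneg_of_telescope
    (f := fun n : ℕ => genHarm s n / ((n : ℝ) + 1) ^ t + genHarm t n / ((n : ℝ) + 1) ^ s
      + 1 / ((n : ℝ) + 1) ^ (s + t)) (g := fun n => genHarm s n * genHarm t n)
    (fun n => by
      have := genHarm_nonneg s n
      have := genHarm_nonneg t n
      positivity)
    (fun n => by
      simp only [genHarm_succ, pow_add]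
      field_simp
      ring)
    ((hasSum_zeta hs).tendsto_sum_nat.mul (hasSum_zeta ht).tendsto_sum_nat)
  simpa [genHarm_zero] using h

lemma hasSum_genHarm_two_div_sq :
    HasSum (fun n : ℕ => genHarm 2 n / ((n : ℝ) + 1) ^ 2) (3 / 4 * zeta 4) := by
  have h := ((hasSum_stuffle le_rfl le_rfl).sub (hasSum_zeta (s := 4) (by norm_num))).div_const 2
  rw [← pow_two, zeta_two_sq] at h
  convert! h using 1
  · ext n
    ring
  · ring

/-! ### Connected sums -/

/-- The connector `n! m! / (n + m)!`. -/
noncomputable def connector (n m : ℕ) : ℝ :=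
  (n.factorial : ℝ) * m.factorial / (n + m).factorial

lemma connector_nonneg (n m : ℕ) : 0 ≤ connector n m := by
  unfold connector
  positivity

lemma connector_comm (n m : ℕ) : connector n m = connector m n := by
  rw [connector, connector, mul_comm, Nat.add_comm]

lemma connector_zero_right (n : ℕ) : connector n 0 = 1 := by
  simp [connector, Nat.factorial_ne_zero]

lemma connector_succ_mul (n m : ℕ) :
    connector n (m + 1) * ((n : ℝ) + m + 1) = connector n m * ((m : ℝ) + 1) := by
  have h := Nat.factorial_succ (n + m)
  have h' := Nat.factorial_succ m
  have h0 : ((n + m).factorial : ℝ) ≠ 0 := by exact_mod_cast Nat.factorial_ne_zero _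
  simp only [connector, ← add_assoc, h, h']
  push_cast
  field_simp

lemma connector_sub_succ (n m : ℕ) :
    connector n m - connector n (m + 1) = n * connector n (m + 1) / ((m : ℝ) + 1) := by
  have h := connector_succ_mul n m
  field_simp
  linarith

lemma connector_le (n m : ℕ) : connector (n + 1) m ≤ 1 / ((m : ℝ) + 1) := by
  have h : ((m : ℝ) + 1) * connector 1 m = 1 := by
    induction m with
    | zero => simp [connector_zero_right]
    | succ m ih =>
      have h := connector_succ_mul 1 m
      push_cast at h ⊢
      linarith
  have anti : connector (n + 1) m ≤ connector 1 m := by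
    induction n with
    | zero => simp
    | succ n ih =>
      refine le_trans ?_ ih
      have h := connector_sub_succ m (n + 1)
      have h' := connector_nonneg m (n + 1 + 1)
      have : 0 ≤ (m : ℝ) * connector m (n + 1 + 1) / (((n + 1 : ℕ) : ℝ) + 1) := by positivity
      rw [connector_comm (n + 1 + 1), connector_comm (n + 1)]
      linarith
  rw [le_div_iff₀ (by positivity)]
  calc connector (n + 1) m * ((m : ℝ) + 1) ≤ connector 1 m * ((m : ℝ) + 1) := by gcongr
    _ = 1 := by rw [mul_comm, h]

/-- The second elementary symmetric function of `1, 1/2, …, 1/n`. -/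
noncomputable def harmPairs (n : ℕ) : ℝ := (harm n ^ 2 - genHarm 2 n) / 2

lemma harmPairs_zero : harmPairs 0 = 0 := by simp [harmPairs, harm_zero, genHarm_zero]

lemma harmPairs_succ (n : ℕ) :
    harmPairs (n + 1) = harmPairs n + harm n / ((n : ℝ) + 1) := by
  simp only [harmPairs, harm_succ, genHarm_succ]
  field_simp
  ring

lemma harmPairs_nonneg (n : ℕ) : 0 ≤ harmPairs n := by
  induction n with
  | zero => rw [harmPairs_zero]
  | succ n ih =>
    have := harm_nonneg n
    rw [harmPairs_succ]
    positivity

lemma harmPairs_le (n : ℕ) : harmPairs n ≤ harm n ^ 2 := by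
  have := genHarm_nonneg 2 n
  have := sq_nonneg (harm n)
  rw [harmPairs]
  linarith

lemma hasSum_connector_div (m : ℕ) :
    HasSum (fun n : ℕ => connector (n + 1) (m + 1) / ((n : ℝ) + 1)) (1 / ((m : ℝ) + 1)) := by
  have hlim : Tendsto (fun n => -(connector n (m + 1) / ((m : ℝ) + 1))) atTop (𝓝 0) := by
    have h0 : Tendsto (fun n => connector n (m + 1)) atTop (𝓝 0) :=
      squeeze_zero (fun n => connector_nonneg _ _)
        (fun n => by rw [connector_comm]; exact connector_le m n)
        tendsto_one_div_add_atTop_nhds_zero_nat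
    simpa using (h0.div_const ((m : ℝ) + 1)).neg
  have h := hasSum_of_nonneg_of_telescope
    (f := fun n : ℕ => connector (n + 1) (m + 1) / ((n : ℝ) + 1))
    (fun n => by
      have := connector_nonneg (n + 1) (m + 1)
      positivity)
    (fun n => by
      have h := connector_sub_succ (m + 1) n
      rw [connector_comm (m + 1), connector_comm (m + 1)] at h
      push_cast at h
      field_simp at h ⊢
      linarith) hlim
  simpa [connector_comm 0, connector_zero_right] using h

lemma hasSum_harmPairs_mul_connector (n : ℕ) :
    HasSum (fun m : ℕ => harmPairs m / ((m : ℝ) + 1) * connector (n + 1) (m + 1))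
      (1 / ((n : ℝ) + 1) ^ 3) := by
  set g : ℕ → ℝ := fun m => -(connector (n + 1) m * (harmPairs m / ((n : ℝ) + 1)
    + harm m / ((n : ℝ) + 1) ^ 2 + 1 / ((n : ℝ) + 1) ^ 3)) with hg
  have hlim : Tendsto g atTop (𝓝 0) := by
    have h2 := tendsto_harm_pow_div 2 0 one_ne_zero
    have h1 := tendsto_harm_pow_div 1 0 one_ne_zero
    have h0 := tendsto_harm_pow_div 0 0 one_ne_zero
    have h := ((h2.div_const ((n : ℝ) + 1)).add (h1.div_const (((n : ℝ) + 1) ^ 2))).add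
      (h0.div_const (((n : ℝ) + 1) ^ 3))
    have hpos : Tendsto (fun m => connector (n + 1) m * (harmPairs m / ((n : ℝ) + 1)
        + harm m / ((n : ℝ) + 1) ^ 2 + 1 / ((n : ℝ) + 1) ^ 3)) atTop (𝓝 0) := by
      simp only [zero_div, add_zero] at h
      refine squeeze_zero (fun m => ?_) (fun m => ?_) h
      · have := connector_nonneg (n + 1) m
        have := harmPairs_nonneg m
        have := harm_nonneg m
        positivity
      · have := harm_nonneg m
        calc connector (n + 1) m * (harmPairs m / ((n : ℝ) + 1)
              + harm m / ((n : ℝ) + 1) ^ 2 + 1 / ((n : ℝ) + 1) ^ 3)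
            ≤ 1 / ((m : ℝ) + 1) * (harm m ^ 2 / ((n : ℝ) + 1)
              + harm m / ((n : ℝ) + 1) ^ 2 + 1 / ((n : ℝ) + 1) ^ 3) := by
              have := harmPairs_nonneg m
              gcongr
              · exact connector_le n m
              · exact harmPairs_le m
          _ = _ := by
              simp only [CharP.cast_eq_zero, add_zero, pow_one, pow_zero]
              field_simp
    simpa [hg] using hpos.neg
  have h := hasSum_of_nonneg_of_telescope
    (f := fun m : ℕ => harmPairs m / ((m : ℝ) + 1) * connector (n + 1) (m + 1))
    (fun m => by
      have := connector_nonneg (n + 1) (m + 1)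
      have := harmPairs_nonneg m
      positivity)
    (fun m => by
      have h := connector_sub_succ (n + 1) m
      rw [sub_eq_iff_eq_add] at h
      simp only [hg, h, harmPairs_succ, harm_succ]
      push_cast
      field_simp
      ring) hlim
  simpa [hg, connector_zero_right, harmPairs_zero, harm_zero] using h

lemma hasSum_harmPairs_div_sq :
    HasSum (fun n : ℕ => harmPairs n / ((n : ℝ) + 1) ^ 2) (zeta 4) := by
  have hF := hasSum_prod_of_nonneg
    (F := fun p : ℕ × ℕ => 1 / ((p.1 : ℝ) + 1) *
      (harmPairs p.2 / ((p.2 : ℝ) + 1) * connector (p.1 + 1) (p.2 + 1)))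
    (A := fun n => 1 / ((n : ℝ) + 1) * (1 / ((n : ℝ) + 1) ^ 3))
    (fun p => by
      have := connector_nonneg (p.1 + 1) (p.2 + 1)
      have := harmPairs_nonneg p.2
      simp only [Pi.zero_apply]
      positivity)
    (fun n => (hasSum_harmPairs_mul_connector n).mul_left (1 / ((n : ℝ) + 1)))
    (s := zeta 4) (by
      convert! hasSum_zeta (s := 4) (by norm_num) using 2 with n
      field_simp)
  refine hF.prod_fiberwise_swap fun m => ?_
  convert! (hasSum_connector_div m).mul_left (harmPairs m / ((m : ℝ) + 1)) using 1
  · ext n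
    ring
  · field_simp

lemma hasSum_harm_sq_div_sq :
    HasSum (fun n : ℕ => harm n ^ 2 / ((n : ℝ) + 1) ^ 2) (11 / 4 * zeta 4) := by
  convert! (hasSum_harmPairs_div_sq.mul_left 2).add hasSum_genHarm_two_div_sq using 1
  · ext n
    rw [harmPairs]
    ring
  · ring

lemma summable_harm_div_pow {s : ℕ} (hs : 2 ≤ s) :
    Summable fun n : ℕ => harm n / ((n : ℝ) + 1) ^ s := by
  refine ((hasSum_zeta le_rfl).summable.add hasSum_harm_sq_div_sq.summable).of_nonneg_of_le
    (fun n => ?_) (fun n => ?_)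
  · have := harm_nonneg n
    positivity
  · rw [← add_div]
    have := harm_nonneg n
    gcongr
    · nlinarith [sq_nonneg (harm n - 1)]
    · have : (0 : ℝ) ≤ n := by positivity
      linarith

/-! ### Euler's sum formula -/

lemma hasSum_one_div_mul_add (n : ℕ) :
    HasSum (fun m : ℕ => 1 / (((m : ℝ) + 1) * ((m : ℝ) + n + 2)))
      (harm (n + 1) / ((n : ℝ) + 1)) := by
  have key : ∀ k : ℕ, HasSum (fun m : ℕ => 1 / ((m : ℝ) + 1) - 1 / ((m : ℝ) + k + 1)) (harm k) := by
    intro k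
    induction k with
    | zero => simp [harm_zero]
    | succ k ih =>
      have hlim : Tendsto (fun m : ℕ => -(1 / ((m : ℝ) + k + 1))) atTop (𝓝 0) := by
        have h := (tendsto_one_div_add_atTop_nhds_zero_nat (𝕜 := ℝ)).comp (tendsto_add_atTop_nat k)
        simpa using h.neg
      have h := hasSum_of_nonneg_of_telescope
        (f := fun m : ℕ => 1 / ((m : ℝ) + k + 1) - 1 / ((m : ℝ) + k + 2))
        (fun m => by
          rw [sub_nonneg]
          gcongr
          norm_num)
        (fun m => by
          push_cast
          ring) hlim
      convert! ih.add h using 1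
      · ext m
        push_cast
        ring
      · rw [harm_succ]
        simp
  convert! (key (n + 1)).div_const ((n : ℝ) + 1) using 1
  ext m
  push_cast
  have : (m : ℝ) + (n + 1) + 1 ≠ 0 := by positivity
  field_simp
  ring

/-- The sum `∑_{n + m = c} 1 / (n ^ s * m * c)` over positive `n` and `m`, at `c = N + 2`. -/
noncomputable def mixedSum (s N : ℕ) : ℝ :=
  ∑ p ∈ antidiagonal N,
    1 / ((p.1 : ℝ) + 1) ^ s * (1 / (((p.2 : ℝ) + 1) * ((p.2 : ℝ) + p.1 + 2)))

lemma mixedSum_zero (N : ℕ) : mixedSum 0 N = harm (N + 1) / ((N : ℝ) + 2) := by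
  rw [mixedSum, ← Nat.sum_antidiagonal_swap, harm, sum_div,
    ← Nat.sum_antidiagonal_eq_sum_range_succ (fun i _ => 1 / ((i : ℝ) + 1) / ((N : ℝ) + 2))]
  refine sum_congr rfl fun p hp => ?_
  rw [← mem_antidiagonal.1 hp]
  simp only [Prod.fst_swap, Prod.snd_swap]
  push_cast
  field_simp

lemma mixedSum_succ (s N : ℕ) :
    mixedSum (s + 1) N = genHarm (s + 1) (N + 1) / ((N : ℝ) + 2) ^ 2
      + mixedSum s N / ((N : ℝ) + 2) := by
  rw [mixedSum, mixedSum, genHarm, sum_div, sum_div,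
    ← Nat.sum_antidiagonal_eq_sum_range_succ
      (fun i _ => 1 / ((i : ℝ) + 1) ^ (s + 1) / ((N : ℝ) + 2) ^ 2), ← sum_add_distrib]
  refine sum_congr rfl fun p hp => ?_
  rw [← mem_antidiagonal.1 hp]
  push_cast
  have : (p.2 : ℝ) + p.1 + 2 ≠ 0 := by positivity
  field_simp
  ring

lemma hasSum_mixedSum {s : ℕ} (hs : s ≠ 0) :
    HasSum (mixedSum s)
      ((∑' n : ℕ, harm n / ((n : ℝ) + 1) ^ (s + 1)) + zeta (s + 2)) := by
  refine (hasSum_prod_of_nonneg (F := fun p : ℕ × ℕ => 1 / ((p.1 : ℝ) + 1) ^ s *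
      (1 / (((p.2 : ℝ) + 1) * ((p.2 : ℝ) + p.1 + 2))))
    (A := fun n => 1 / ((n : ℝ) + 1) ^ s * (harm (n + 1) / ((n : ℝ) + 1))) (fun p => ?_)
    (fun n => (hasSum_one_div_mul_add n).mul_left (1 / ((n : ℝ) + 1) ^ s)) ?_).sum_antidiagonal
  · simp only [Pi.zero_apply]
    positivity
  · convert! (summable_harm_div_pow (s := s + 1) (by omega)).hasSum.add
      (hasSum_zeta (s := s + 2) (by omega)) using 2 with n
    rw [harm_succ]
    field_simp
    ring

lemma hasSum_harm_div_sq : HasSum (fun n : ℕ => harm n / ((n : ℝ) + 1) ^ 2) (zeta 3) := by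
  have hE := (summable_harm_div_pow (s := 2) le_rfl).hasSum
  set E := ∑' n : ℕ, harm n / ((n : ℝ) + 1) ^ 2
  have h := hasSum_mixedSum (s := 1) one_ne_zero
  have h' := (hasSum_nat_add_iff' 1).2 (hE.mul_left 2)
  have hEq : E + zeta 3 = 2 * E := by
    have := h.unique (a₂ := 2 * E - 0) (by
      convert! h' using 1
      · ext N
        rw [mixedSum_succ, mixedSum_zero, zero_add, genHarm_one]
        push_cast
        field_simp
        ring
      · simp [harm_zero])
    linarith
  have : E = zeta 3 := by linarith
  rwa [this] at hE

lemma hasSum_harm_div_cube :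
    HasSum (fun n : ℕ => harm n / ((n : ℝ) + 1) ^ 3) (1 / 4 * zeta 4) := by
  have hE := (summable_harm_div_pow (s := 3) (by norm_num)).hasSum
  set E := ∑' n : ℕ, harm n / ((n : ℝ) + 1) ^ 3
  have h := hasSum_mixedSum (s := 2) two_ne_zero
  have h' := (hasSum_nat_add_iff' 1).2 (hasSum_genHarm_two_div_sq.add (hE.mul_left 2))
  have hEq := h.unique (a₂ := 3 / 4 * zeta 4 + 2 * E - 0) (by
    convert! h' using 1
    · ext N
      rw [mixedSum_succ, mixedSum_succ, mixedSum_zero, zero_add, genHarm_one]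
      push_cast
      field_simp
      ring
    · simp [harm_zero, genHarm_zero])
  have : E = 1 / 4 * zeta 4 := by linarith
  rwa [this] at hE

lemma hasSum_harm_div_fourth :
    HasSum (fun n : ℕ => harm n / ((n : ℝ) + 1) ^ 4) (2 * zeta 5 - zeta 2 * zeta 3) := by
  have hE := (summable_harm_div_pow (s := 4) (by norm_num)).hasSum
  set E := ∑' n : ℕ, harm n / ((n : ℝ) + 1) ^ 4
  have h := hasSum_mixedSum (s := 3) three_ne_zero
  have h' := (hasSum_nat_add_iff' 1).2 (((hasSum_stuffle (s := 2) (t := 3) le_rfl (by norm_num)).sub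
    (hasSum_zeta (s := 5) (by norm_num))).add (hE.mul_left 2))
  have hEq := h.unique (a₂ := zeta 2 * zeta 3 - zeta 5 + 2 * E - 0) (by
    convert! h' using 1
    · ext N
      rw [mixedSum_succ, mixedSum_succ, mixedSum_succ, mixedSum_zero, zero_add, genHarm_one]
      push_cast
      field_simp
      ring
    · simp [harm_zero, genHarm_zero])
  have : E = 2 * zeta 5 - zeta 2 * zeta 3 := by linarith
  rwa [this] at hE

/-! ### The quartic harmonic sum -/

/-- The boundary term left by summing the quartic harmonic series by parts. -/
noncomputable def quarticTail (k : ℕ) : ℝ :=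
  (-(5 / 12)) * (harm k ^ 1 / ((k : ℝ) + 1 + (0 : ℕ)) ^ 1)
    + 11 / 8 * (harm k ^ 1 / ((k : ℝ) + 1 + (0 : ℕ)) ^ 2)
    + (-(1 / 2)) * (harm k ^ 1 / ((k : ℝ) + 1 + (0 : ℕ)) ^ 3)
    + (-(1 / 2)) * (harm k ^ 1 / ((k : ℝ) + 1 + (0 : ℕ)) ^ 4)
    + 77 / 72 * (harm k ^ 1 / ((k : ℝ) + 1 + (1 : ℕ)) ^ 1)
    + (-(1 / 6)) * (harm k ^ 1 / ((k : ℝ) + 1 + (1 : ℕ)) ^ 2)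
    + (-(1 / 2)) * (harm k ^ 1 / ((k : ℝ) + 1 + (1 : ℕ)) ^ 3)
    + (-(5 / 24)) * (harm k ^ 1 / ((k : ℝ) + 1 + (2 : ℕ)) ^ 1)
    + (-(1 / 8)) * (harm k ^ 1 / ((k : ℝ) + 1 + (2 : ℕ)) ^ 2)
    + 67 / 36 * (harm k ^ 2 / ((k : ℝ) + 1 + (0 : ℕ)) ^ 1)
    + (-(5 / 12)) * (harm k ^ 2 / ((k : ℝ) + 1 + (0 : ℕ)) ^ 2)
    + (-1) * (harm k ^ 2 / ((k : ℝ) + 1 + (0 : ℕ)) ^ 3)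
    + (-(133 / 72)) * (harm k ^ 2 / ((k : ℝ) + 1 + (1 : ℕ)) ^ 1)
    + (-(7 / 6)) * (harm k ^ 2 / ((k : ℝ) + 1 + (1 : ℕ)) ^ 2)
    + 1 / 2 * (harm k ^ 2 / ((k : ℝ) + 1 + (1 : ℕ)) ^ 3)
    + 17 / 72 * (harm k ^ 2 / ((k : ℝ) + 1 + (2 : ℕ)) ^ 1)
    + 1 / 3 * (harm k ^ 2 / ((k : ℝ) + 1 + (2 : ℕ)) ^ 2)
    + 5 / 18 * (harm k ^ 3 / ((k : ℝ) + 1 + (0 : ℕ)) ^ 1)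
    + (-(2 / 3)) * (harm k ^ 3 / ((k : ℝ) + 1 + (0 : ℕ)) ^ 2)
    + (-(5 / 9)) * (harm k ^ 3 / ((k : ℝ) + 1 + (1 : ℕ)) ^ 1)
    + 5 / 6 * (harm k ^ 3 / ((k : ℝ) + 1 + (1 : ℕ)) ^ 2)
    + 5 / 18 * (harm k ^ 3 / ((k : ℝ) + 1 + (2 : ℕ)) ^ 1)
    + (-(1 / 6)) * (harm k ^ 3 / ((k : ℝ) + 1 + (2 : ℕ)) ^ 2)
    + (-(1 / 6)) * (harm k ^ 4 / ((k : ℝ) + 1 + (0 : ℕ)) ^ 1)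
    + 1 / 3 * (harm k ^ 4 / ((k : ℝ) + 1 + (1 : ℕ)) ^ 1)
    + (-(1 / 6)) * (harm k ^ 4 / ((k : ℝ) + 1 + (2 : ℕ)) ^ 1)

lemma quarticTail_zero : quarticTail 0 = 0 := by simp [quarticTail, harm_zero]

lemma tendsto_quarticTail : Tendsto quarticTail atTop (𝓝 0) := by
  have h (c : ℝ) (a j b : ℕ) (hb : b ≠ 0 := by norm_num) :=
    (tendsto_harm_pow_div a j hb).const_mul c
  simp only [mul_zero] at h
  have hsum := h (-(5 / 12)) 1 0 1
    |>.add (h (11 / 8) 1 0 2)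
    |>.add (h (-(1 / 2)) 1 0 3)
    |>.add (h (-(1 / 2)) 1 0 4)
    |>.add (h (77 / 72) 1 1 1)
    |>.add (h (-(1 / 6)) 1 1 2)
    |>.add (h (-(1 / 2)) 1 1 3)
    |>.add (h (-(5 / 24)) 1 2 1)
    |>.add (h (-(1 / 8)) 1 2 2)
    |>.add (h (67 / 36) 2 0 1)
    |>.add (h (-(5 / 12)) 2 0 2)
    |>.add (h (-1) 2 0 3)
    |>.add (h (-(133 / 72)) 2 1 1)
    |>.add (h (-(7 / 6)) 2 1 2)
    |>.add (h (1 / 2) 2 1 3)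
    |>.add (h (17 / 72) 2 2 1)
    |>.add (h (1 / 3) 2 2 2)
    |>.add (h (5 / 18) 3 0 1)
    |>.add (h (-(2 / 3)) 3 0 2)
    |>.add (h (-(5 / 9)) 3 1 1)
    |>.add (h (5 / 6) 3 1 2)
    |>.add (h (5 / 18) 3 2 1)
    |>.add (h (-(1 / 6)) 3 2 2)
    |>.add (h (-(1 / 6)) 4 0 1)
    |>.add (h (1 / 3) 4 1 1)
    |>.add (h (-(1 / 6)) 4 2 1)
  simp only [add_zero] at hsum
  exact hsum

lemma quartic_term_eq (k : ℕ) :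
    harm (k + 1) * harm (k + 2) * harm (k + 3) * harm (k + 4) /
        (((k : ℝ) + 1) * ((k : ℝ) + 2) * ((k : ℝ) + 3) * ((k : ℝ) + 4)) =
      (1 / 4 * (harm k ^ 2 / ((k : ℝ) + 1) ^ 2) + 1 / 6 * (harm k / ((k : ℝ) + 1) ^ 4)
        + 2 / 3 * (harm k / ((k : ℝ) + 1) ^ 3) - 1 / 18 * (harm k / ((k : ℝ) + 1) ^ 2)
        + 1 / 6 * (1 / ((k : ℝ) + 1) ^ 5) + 17 / 36 * (1 / ((k : ℝ) + 1) ^ 4)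
        - 17 / 72 * (1 / ((k : ℝ) + 1) ^ 3) - 4 / 9 * (1 / ((k : ℝ) + 1) ^ 2))
      + (quarticTail (k + 1) - quarticTail k) := by
  have h2 : harm (k + 2) = harm k + 1 / ((k : ℝ) + 1) + 1 / ((k : ℝ) + 2) := by
    rw [harm_succ, harm_succ]; push_cast; ring
  have h3 : harm (k + 3) = harm k + 1 / ((k : ℝ) + 1) + 1 / ((k : ℝ) + 2) + 1 / ((k : ℝ) + 3) := by
    rw [harm_succ, h2]; push_cast; ring
  have h4 : harm (k + 4) = harm k + 1 / ((k : ℝ) + 1) + 1 / ((k : ℝ) + 2) + 1 / ((k : ℝ) + 3)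
      + 1 / ((k : ℝ) + 4) := by
    rw [harm_succ, h3]; push_cast; ring
  rw [h4, h3, h2]
  simp only [quarticTail, harm_succ]
  push_cast
  have e2 : (k : ℝ) + 1 + 1 = k + 2 := by ring
  have e3 : (k : ℝ) + 1 + 2 = k + 3 := by ring
  have e4 : (k : ℝ) + 2 + 1 = k + 3 := by ring
  have e5 : (k : ℝ) + 2 + 2 = k + 4 := by ring
  simp only [add_zero, e2, e3, e4, e5]
  generalize harm k = H
  field_simp
  ring

lemma tsum_quartic :
    (∑' k : ℕ, (harm (k + 1) * harm (k + 2) * harm (k + 3) * harm (k + 4)) /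
        (((k : ℝ) + 1) * ((k : ℝ) + 2) * ((k : ℝ) + 3) * ((k : ℝ) + 4))) =
      -(4 / 9) * zeta 2 - 7 / 24 * zeta 3 + 191 / 144 * zeta 4 + 1 / 2 * zeta 5
        - 1 / 6 * (zeta 2 * zeta 3) := by
  have hmain := (((((((hasSum_harm_sq_div_sq.mul_left (1 / 4)).add
    (hasSum_harm_div_fourth.mul_left (1 / 6))).add
    (hasSum_harm_div_cube.mul_left (2 / 3))).sub
    (hasSum_harm_div_sq.mul_left (1 / 18))).add
    ((hasSum_zeta (s := 5) (by norm_num)).mul_left (1 / 6))).add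
    ((hasSum_zeta (s := 4) (by norm_num)).mul_left (17 / 36))).sub
    ((hasSum_zeta (s := 3) (by norm_num)).mul_left (17 / 72))).sub
    ((hasSum_zeta (s := 2) le_rfl).mul_left (4 / 9))
  refine HasSum.tsum_eq ((hasSum_iff_tendsto_nat_of_nonneg (fun k => ?_) _).2 ?_)
  · have := harm_nonneg (k + 1)
    have := harm_nonneg (k + 2)
    have := harm_nonneg (k + 3)
    have := harm_nonneg (k + 4)
    positivity
  · simp only [quartic_term_eq]
    simp only [sum_add_distrib (g := fun k => quarticTail (k + 1) - quarticTail k),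
      sum_range_sub, quarticTail_zero, sub_zero]
    convert! hmain.tendsto_sum_nat.add tendsto_quarticTail using 2
    ring

theorem stmt_15 :
    (∃ a2 a3 a4 a5 : ℚ,
        (∑' k : ℕ,
          (harm (k + 1) * harm (k + 2) * harm (k + 3) * harm (k + 4)) /
            (((k : ℝ) + 1) * ((k : ℝ) + 2) * ((k : ℝ) + 3) * ((k : ℝ) + 4))) =
          (a2 : ℝ) * zeta 2 + (a3 : ℝ) * zeta 3 + (a4 : ℝ) * zeta 4 + (a5 : ℝ) * zeta 5) ↔
      zeta 2 * zeta 3 ∈ Submodule.span ℚ ({zeta 2, zeta 3, zeta 4, zeta 5} : Set ℝ) := by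
  rw [tsum_quartic]
  simp only [Submodule.mem_span_insert, Submodule.mem_span_singleton, Rat.smul_def]
  constructor
  · rintro ⟨a2, a3, a4, a5, h⟩
    refine ⟨-6 * a2 - 8 / 3, _, ⟨-6 * a3 - 7 / 4, _, ⟨-6 * a4 + 191 / 24, _,
      ⟨-6 * a5 + 3, rfl⟩, rfl⟩, rfl⟩, ?_⟩
    push_cast
    linarith
  · rintro ⟨b2, _, ⟨b3, _, ⟨b4, _, ⟨b5, rfl⟩, rfl⟩, rfl⟩, h⟩
    refine ⟨-(4 / 9) - b2 / 6, -(7 / 24) - b3 / 6, 191 / 144 - b4 / 6, 1 / 2 - b5 / 6, ?_⟩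
    rw [h]
    push_cast
    ring
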